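/- arXiv:1803.07664 — 12 statements merged into one kernel-verified Lean document; each statement's English description precedes it below -/
import Mathlib

section
/- Let p, k be natural numbers and let w be a polynomial in p real variables (w : MvPolynomial (Fin p) ℝ) with total degree at most k. If the evaluation map u ↦ w(u) satisfies w(u) = o(‖u‖^k) as u → 0 in ℝ^p, then w is the zero polynomial. -/
open Filter Asymptotics Topology

theorem uni_aux (k : ℕ) : ∀ (q : Polynomial ℝ), q.natDegree ≤ k →
    (fun t : ℝ => q.eval t) =o[𝓝[≠] 0] (fun t => t ^ k) → q = 0 := by
  induction k with
  | zero =>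
    intro q hq h
    rw [Polynomial.eq_C_of_natDegree_le_zero hq] at h ⊢
    simp only [Polynomial.eval_C, pow_zero, isLittleO_one_iff] at h
    rw [tendsto_nhds_unique h tendsto_const_nhds |>.symm]
    simp
  | succ k ih =>
    intro q hq h
    have h1 : Tendsto (fun t : ℝ => q.eval t) (𝓝[≠] 0) (𝓝 0) := by
      refine h.trans_tendsto ?_
      have : Tendsto (fun t : ℝ => t ^ (k+1)) (𝓝 0) (𝓝 (0 ^ (k+1))) :=
        (continuous_pow (k+1)).tendsto 0
      rw [zero_pow (by omega)] at this
      exact this.mono_left nhdsWithin_le_nhds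
    have h2 : Tendsto (fun t : ℝ => q.eval t) (𝓝[≠] 0) (𝓝 (q.eval 0)) :=
      (q.continuous.tendsto 0).mono_left nhdsWithin_le_nhds
    have h0 : q.coeff 0 = 0 := by
      rw [Polynomial.coeff_zero_eq_eval_zero]; exact tendsto_nhds_unique h2 h1
    have hd : q = q.divX * Polynomial.X := by
      conv_lhs => rw [← q.divX_mul_X_add, h0]
      simp
    have := ih q.divX (by rw [Polynomial.natDegree_divX_eq_natDegree_tsub_one]; omega) (by
      rw [isLittleO_iff] at h ⊢
      intro c hc
      filter_upwards [h hc, self_mem_nhdsWithin] with t ht ht0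
      have ht0 : 0 < ‖t‖ := norm_pos_iff.2 ht0
      rw [hd, Polynomial.eval_mul, Polynomial.eval_X, pow_succ, norm_mul, norm_mul,
        ← mul_assoc] at ht
      exact le_of_mul_le_mul_right ht ht0)
    rw [hd, this, zero_mul]

theorem poly_littleO_deg_le_eq_zero
    (p k : ℕ) (w : MvPolynomial (Fin p) ℝ) (hdeg : w.totalDegree ≤ k)
    (h : (fun u : EuclideanSpace ℝ (Fin p) => MvPolynomial.eval u w) =o[𝓝 0]
      fun u => ‖u‖ ^ k) :
    w = 0 := by
  apply MvPolynomial.funext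
  intro x
  let f : Fin p → Polynomial ℝ := fun i => Polynomial.C (x i) * Polynomial.X
  have hev (t : ℝ) : (MvPolynomial.aeval f w).eval t
      = MvPolynomial.eval (t • WithLp.toLp 2 x : EuclideanSpace ℝ (Fin p)) w := by
    rw [← Polynomial.coe_evalRingHom, MvPolynomial.aeval_def, MvPolynomial.hom_eval₂,
      MvPolynomial.eval, MvPolynomial.coe_eval₂Hom]
    congr 1
    · exact Subsingleton.elim _ _
    · ext i
      simp only [f, Function.comp, Polynomial.coe_evalRingHom, Polynomial.eval_mul, Polynomial.eval_C, Polynomial.eval_X, PiLp.smul_apply, smul_eq_mul]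
      exact mul_comm _ _
  have hq : MvPolynomial.aeval f w = 0 := by
    apply uni_aux k
    · have := MvPolynomial.aeval_natDegree_le w hdeg f (n := 1)
        (fun i => (Polynomial.natDegree_C_mul_le _ _).trans Polynomial.natDegree_X_le)
      simpa using this
    · simp only [hev]
      have ht : Tendsto (fun t : ℝ => t • (WithLp.toLp 2 x : EuclideanSpace ℝ (Fin p)))
          (𝓝[≠] 0) (𝓝 0) := by
        have : Continuous (fun t : ℝ => t • (WithLp.toLp 2 x : EuclideanSpace ℝ (Fin p))) := by
          fun_prop
        have := this.tendsto 0
        rw [zero_smul] at this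
        exact this.mono_left nhdsWithin_le_nhds
      refine (h.comp_tendsto ht).trans_isBigO ?_
      refine IsBigO.of_bound (‖(WithLp.toLp 2 x : EuclideanSpace ℝ (Fin p))‖ ^ k)
        (Eventually.of_forall fun t => ?_)
      simp [norm_smul, mul_pow, mul_comm]
  have := hev 1
  rw [hq] at this
  simpa using this.symm
end

section
/- Let E and F be real normed vector spaces, n a natural number, x⁰ ∈ E, and let f : E → F be C^n at x⁰ (ContDiffAt ℝ n f x⁰). If iteratedFDeriv ℝ i f x⁰ = 0 for every i ≤ n, then f(x⁰ + h) = o(‖h‖^n) as h → 0 (Taylor's theorem with Peano remainder in the case of vanishing Taylor polynomial). -/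
open Filter Asymptotics Topology

theorem taylor_peano_vanishing
    {E F : Type*} [NormedAddCommGroup E] [NormedSpace ℝ E]
    [NormedAddCommGroup F] [NormedSpace ℝ F]
    (n : ℕ) (x0 : E) (f : E → F) (hf : ContDiffAt ℝ n f x0)
    (hder : ∀ i ≤ n, iteratedFDeriv ℝ i f x0 = 0) :
    (fun h => f (x0 + h)) =o[𝓝 0] fun h => ‖h‖ ^ n := by
  have key : ∀ k i : ℕ, i + k = n →
      (iteratedFDeriv ℝ i f) =o[𝓝 x0] fun x => ‖x - x0‖ ^ k := by
    intro k
    induction k with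
    | zero =>
      intro i hi
      have hi' : i = n := by omega
      have hc := hf.continuousAt_iteratedFDeriv (k := i) (by rw [hi'])
      simp only [pow_zero]
      rw [isLittleO_one_iff]
      have := hc.tendsto
      rwa [hder i hi'.le] at this
    | succ k ih =>
      intro i hi
      have h1 := ih (i + 1) (by omega)
      obtain ⟨r, hr, hball⟩ := Metric.eventually_nhds_iff_ball.1 (hf.eventually (by simp))
      have hx0 : x0 ∈ Metric.ball x0 r := Metric.mem_ball_self hr
      have h2 := (convex_ball x0 r).isLittleO_pow_succ (n := k)
        (f := iteratedFDeriv ℝ i f) (f' := fderiv ℝ (iteratedFDeriv ℝ i f)) hx0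
        (fun x hx => ((hball x hx).differentiableAt_iteratedFDeriv
          (by exact_mod_cast (by omega : i < n))).hasFDerivAt.hasFDerivWithinAt)
        (by
          rw [Metric.isOpen_ball.nhdsWithin_eq hx0]
          rw [← isLittleO_norm_left] at h1 ⊢
          simpa only [norm_fderiv_iteratedFDeriv] using h1)
      rw [Metric.isOpen_ball.nhdsWithin_eq hx0] at h2
      simpa only [hder i (by omega), sub_zero] using h2
  have h0 := key n 0 (by omega)
  rw [← isLittleO_norm_left] at h0
  simp only [norm_iteratedFDeriv_zero] at h0
  have ht : Tendsto (fun h : E => x0 + h) (𝓝 0) (𝓝 x0) := by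
    have : Continuous (fun h : E => x0 + h) := by fun_prop
    simpa using this.tendsto 0
  have h3 := h0.comp_tendsto ht
  rw [← isLittleO_norm_left]
  simpa [Function.comp_def] using h3
end

section
/- Let p, s be natural numbers, u⁰ ∈ ℝ^p, and let F : ℝ^p → ℝ be C^{s+1} at u⁰ with iteratedFDeriv ℝ i F u⁰ = 0 for all i ≤ s. Suppose w ∈ ℝ^p satisfies iteratedFDeriv ℝ (s+1) F u⁰ (fun _ => w) ≠ 0. Then for every real c ≠ 0 and every curve ũ : ℝ → ℝ^p with ũ(0) = u⁰ which is differentiable at 0 with derivative c • w (HasDerivAt ũ (c • w) 0), it is NOT the case that F(ũ(t)) = o(|t|^{s+1}) as t → 0. -/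
open Filter Asymptotics Topology

set_option maxHeartbeats 1000000 in
theorem not_littleO_along_curve
    (p s : ℕ) (u0 : EuclideanSpace ℝ (Fin p))
    (F : EuclideanSpace ℝ (Fin p) → ℝ)
    (hF : ContDiffAt ℝ (s + 1) F u0)
    (hvanish : ∀ i ≤ s, iteratedFDeriv ℝ i F u0 = 0)
    (w : EuclideanSpace ℝ (Fin p))
    (hw : iteratedFDeriv ℝ (s + 1) F u0 (fun _ => w) ≠ 0)
    (c : ℝ) (hc : c ≠ 0)
    (ut : ℝ → EuclideanSpace ℝ (Fin p)) (hu0 : ut 0 = u0)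
    (hder : HasDerivAt ut (c • w) 0) :
    ¬ ((fun t => F (ut t)) =o[𝓝 0] fun t => |t| ^ (s + 1)) := by
  intro ho
  set D := iteratedFDeriv ℝ (s + 1) F with hD
  have hcontD : ∀ x, ContDiffAt ℝ (s + 1) F x → ContinuousAt D x := fun x hx =>
    (hx.iteratedFDeriv_right (i := s + 1) (m := 0) (by simp)).continuousAt
  have hA : D u0 (fun _ => c • w) ≠ 0 := by
    have := (D u0).map_smul_univ (fun _ => c) (fun _ => w)
    rw [this]
    simp [hc, hw]
  set A := D u0 (fun _ => c • w) with hAdef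
  -- the pairing is jointly continuous
  have hphi : ContinuousAt (fun q : EuclideanSpace ℝ (Fin p) × EuclideanSpace ℝ (Fin p) =>
      D q.1 (fun _ => q.2)) (u0, c • w) := by
    have h1 : ContinuousAt (fun q : EuclideanSpace ℝ (Fin p) × EuclideanSpace ℝ (Fin p) =>
      D q.1) (u0, c • w) := ContinuousAt.comp (f := Prod.fst) (hcontD u0 hF) continuousAt_fst
    exact h1.eval (by fun_prop)
  have hphiT : Tendsto (fun q : EuclideanSpace ℝ (Fin p) × EuclideanSpace ℝ (Fin p) =>
      D q.1 (fun _ => q.2)) (𝓝 (u0, c • w)) (𝓝 A) := hphi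
  clear_value A
  clear_value D
  have hv : Tendsto (fun t => t⁻¹ • (ut t - u0)) (𝓝[≠] 0) (𝓝 (c • w)) := by
    have := hder.tendsto_slope_zero
    simpa [hu0] using this
  have hy : Tendsto (fun t => ut t - u0) (𝓝[≠] 0) (𝓝 0) := by
    have := (hder.continuousAt.tendsto.mono_left (nhdsWithin_le_nhds (s := {0}ᶜ))).sub_const u0
    simpa [hu0] using this
  have hgood : ∀ᶠ x in 𝓝 u0, ContDiffAt ℝ (s + 1) F x := by
    have := hF.eventually (by exact_mod_cast WithTop.coe_ne_top)
    simpa using this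
  have hbd : ∀ᶠ q in 𝓝 (u0, c • w), ‖D q.1 (fun _ => q.2)‖ ≤ ‖A‖ + 1 :=
    (hphiT.norm.eventually_lt_const (show ‖A‖ < ‖A‖ + 1 by simp)).mono fun _ h => h.le
  rw [nhds_prod_eq, eventually_prod_iff] at hbd
  obtain ⟨pa, hpa, pb, hpb, hab⟩ := hbd
  obtain ⟨δ, hδ, hball⟩ := Metric.eventually_nhds_iff.1 (hgood.and hpa)
  have hyδ : ∀ᶠ t in 𝓝[≠] (0:ℝ), ∀ r ∈ Set.Icc (0:ℝ) 1,
      dist (u0 + r • (ut t - u0)) u0 < δ := by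
    have := hy.norm.eventually_lt_const (show ‖(0 : EuclideanSpace ℝ (Fin p))‖ < δ by simpa)
    filter_upwards [this] with t ht r hr
    rw [dist_eq_norm, add_sub_cancel_left, norm_smul, Real.norm_eq_abs, abs_of_nonneg hr.1]
    exact (mul_le_of_le_one_left (norm_nonneg _) hr.2).trans_lt ht
  set I : ℝ → ℝ := fun t => ∫ r in (0:ℝ)..1,
    (1 - r) ^ s * D (u0 + r • (ut t - u0)) (fun _ => t⁻¹ • (ut t - u0)) with hI
  have hlim : Tendsto I (𝓝[≠] 0) (𝓝 (∫ r in (0:ℝ)..1, (1 - r) ^ s * A)) := by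
    apply intervalIntegral.tendsto_integral_filter_of_dominated_convergence (fun _ => ‖A‖ + 1)
    · filter_upwards [hyδ] with t ht
      apply ContinuousOn.aestronglyMeasurable _ measurableSet_uIoc
      intro r hr
      rw [Set.uIoc_of_le zero_le_one] at hr
      have h1 := hcontD _ (hball (ht r ⟨hr.1.le, hr.2⟩)).1
      have h2 : ContinuousAt (fun r : ℝ => D (u0 + r • (ut t - u0))) r :=
        ContinuousAt.comp (f := fun r : ℝ => u0 + r • (ut t - u0)) h1 (by fun_prop)
      exact (ContinuousAt.mul (by fun_prop) (h2.eval continuousAt_const)).continuousWithinAt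
    · filter_upwards [hyδ, hv.eventually hpb] with t ht ht2
      refine Eventually.of_forall fun r hr => ?_
      rw [Set.uIoc_of_le zero_le_one] at hr
      have h1 := hab (hball (ht r ⟨hr.1.le, hr.2⟩)).2 ht2
      rw [norm_mul, norm_pow]
      refine (mul_le_of_le_one_left (norm_nonneg _) (pow_le_one₀ (norm_nonneg _) ?_)).trans h1
      rw [Real.norm_eq_abs, abs_le]
      constructor <;> linarith [hr.1, hr.2]
    · simp
    · refine Eventually.of_forall fun r hr => ?_
      have h3 : Tendsto (fun t => u0 + r • (ut t - u0)) (𝓝[≠] 0) (𝓝 u0) := by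
        simpa using (hy.const_smul r).const_add u0
      have h4 : Tendsto (fun t => D (u0 + r • (ut t - u0)) (fun _ => t⁻¹ • (ut t - u0)))
          (𝓝[≠] 0) (𝓝 A) :=
        Tendsto.comp (g := fun q : EuclideanSpace ℝ (Fin p) × EuclideanSpace ℝ (Fin p) =>
          D q.1 (fun _ => q.2)) hphiT (h3.prodMk_nhds hv)
      exact h4.const_mul ((1 - r) ^ s)
  have hval : (∫ r in (0:ℝ)..1, (1 - r) ^ s * A) = A / (s + 1) := by
    rw [intervalIntegral.integral_mul_const,
      intervalIntegral.integral_comp_sub_left (fun r => r ^ s) 1]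
    simp [integral_pow]
    ring
  have hFI : ∀ᶠ t in 𝓝[≠] (0:ℝ), F (ut t) / t ^ (s + 1) = (s.factorial : ℝ)⁻¹ * I t := by
    filter_upwards [hyδ, self_mem_nhdsWithin] with t ht ht0
    have ht0 : t ≠ 0 := ht0
    have hT := map_add_eq_sum_add_integral_iteratedFDeriv (f := F) (x := u0) (y := ut t - u0)
      (n := s) (fun r hr => (hball (ht r hr)).1)
    rw [← hD, Finset.sum_eq_zero, zero_add, add_sub_cancel] at hT
    · have : ∀ r : ℝ, (1 - r) ^ s * D (u0 + r • (ut t - u0)) (fun _ => t⁻¹ • (ut t - u0))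
          = ((1 - r) ^ s • D (u0 + r • (ut t - u0)) (fun _ => (ut t - u0))) * (t⁻¹) ^ (s + 1) := by
        intro r
        have := (D (u0 + r • (ut t - u0))).map_smul_univ (fun _ => t⁻¹) (fun _ => ut t - u0)
        rw [this]
        simp
        ring
      simp only [hI, this]
      rw [intervalIntegral.integral_mul_const, hT, smul_eq_mul, inv_pow, div_eq_mul_inv, mul_assoc]
    · intro i hi
      rw [hvanish i (by simpa [Nat.lt_succ_iff] using hi)]
      simp
  have ho' : Tendsto (fun t => F (ut t) / t ^ (s + 1)) (𝓝[≠] 0) (𝓝 0) := by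
    have h1 : (fun t => F (ut t)) =o[𝓝[≠] 0] fun t : ℝ => t ^ (s + 1) := by
      refine (ho.mono nhdsWithin_le_nhds).trans_isBigO (IsBigO.of_bound 1 ?_)
      exact Eventually.of_forall fun t => by simp
    exact h1.tendsto_div_nhds_zero
  have hfin := tendsto_nhds_unique (ho'.congr' hFI) (hlim.const_mul _)
  rw [hval] at hfin
  have : (s.factorial : ℝ) ≠ 0 := by exact_mod_cast s.factorial_ne_zero
  have h2 : (s : ℝ) + 1 ≠ 0 := by positivity
  exact absurd hfin.symm (mul_ne_zero (inv_ne_zero this) (div_ne_zero hA h2))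
end

section
/- Let p, q ≥ 1 and s be natural numbers, and let F : ℝ^p → ℝ^q be C^{s+1} at 0 with F(0) = 0, iteratedFDeriv ℝ i F 0 = 0 for all i ≤ s, and iteratedFDeriv ℝ (s+1) F 0 ≠ 0. Then there exists a nonzero vector w ∈ ℝ^p with the following property: for all reals a ≠ 0, b ≠ 0 and all curves u, ũ : ℝ → ℝ^p with u(0) = ũ(0) = 0, differentiable at 0 with derivatives a • w and b • w respectively, the curves γ(t) = (u(t), 0) and γ̃(t) = (ũ(t), F(ũ(t))) in ℝ^p × ℝ^q (lying, respectively, in the plane ℝ^p × {0} and in the graph of F) satisfy: γ(t) − γ̃(t) is NOT o(|t|^{s+1}) as t → 0. -/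
open Filter Asymptotics Topology

section helpers
variable {E G : Type*} [NormedAddCommGroup E] [NormedSpace ℝ E]
  [NormedAddCommGroup G] [NormedSpace ℝ G]

lemma hasFDerivAt_apply_flip {g : E → E →L[ℝ] G} {x : E} (hg : DifferentiableAt ℝ g x) (c : E) :
    HasFDerivAt (fun y => g y c) ((fderiv ℝ g x).flip c) x := by
  simpa using hg.hasFDerivAt.clm_apply (hasFDerivAt_const c x)

lemma iteratedFDeriv_swap_zero {m : ℕ} {f : E → G} {x : E}
    (hf : ContDiffAt ℝ ((m + 2 : ℕ) : WithTop ℕ∞) f x) (v : Fin (m + 2) → E) :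
    iteratedFDeriv ℝ (m + 2) f x v =
      fderiv ℝ (fderiv ℝ (iteratedFDeriv ℝ m f)) x (v 0) (v 1) (fun i => v i.succ.succ) := by
  have h2 : ContDiffAt ℝ 2 (iteratedFDeriv ℝ m f) x :=
    hf.iteratedFDeriv_right (by norm_cast; omega)
  have hd : DifferentiableAt ℝ (fderiv ℝ (iteratedFDeriv ℝ m f)) x :=
    (h2.fderiv_right (m := 1) (by norm_num)).differentiableAt (by simp)
  have hd1 : DifferentiableAt ℝ (iteratedFDeriv ℝ (m + 1) f) x :=
    hf.differentiableAt_iteratedFDeriv (by exact_mod_cast Nat.lt_succ_self _)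
  rw [hd1.iteratedFDeriv_succ_apply_left']
  have e : (fun y => iteratedFDeriv ℝ (m + 1) f y (Fin.tail v)) =
      fun y => (ContinuousMultilinearMap.apply ℝ (fun _ : Fin m => E) G (fun i => v i.succ.succ))
        (fderiv ℝ (iteratedFDeriv ℝ m f) y (v 1)) := by
    ext1 y; rfl
  rw [e]
  have h3 := hasFDerivAt_apply_flip hd (v 1)
  have h4 := (ContinuousMultilinearMap.apply ℝ (fun _ : Fin m => E) G
    (fun i => v i.succ.succ)).hasFDerivAt.comp x h3
  have h5 := h4.fderiv
  simp only [Function.comp_def] at h5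
  rw [h5]
  rfl

lemma contDiffAt_symm_iteratedFDeriv (n : ℕ) {f : E → G} :
    ∀ {x : E}, ContDiffAt ℝ (n : WithTop ℕ∞) f x → ∀ (v : Fin n → E) (σ : Equiv.Perm (Fin n)),
      iteratedFDeriv ℝ n f x (v ∘ σ) = iteratedFDeriv ℝ n f x v := by
  induction n with
  | zero => intro x _ v σ; congr 1; ext i; exact i.elim0
  | succ n ih =>
    intro x hf v σ
    have hσ : σ ∈ Submonoid.closure
        (Set.range fun i : Fin n => Equiv.swap i.castSucc i.succ) := by
      rw [Equiv.Perm.mclosure_swap_castSucc_succ]; trivial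
    induction hσ using Submonoid.closure_induction generalizing v with
    | one => rfl
    | mul σ τ _ _ h1 h2 =>
      have : v ∘ ⇑(σ * τ) = (v ∘ σ) ∘ τ := rfl
      rw [this, h2, h1]
    | mem σ hs =>
      obtain ⟨i, rfl⟩ := hs
      have hlt : (n : WithTop ℕ∞) < ((n + 1 : ℕ) : WithTop ℕ∞) := by
        exact_mod_cast Nat.lt_succ_self n
      rcases n with _ | m
      · exact i.elim0
      · refine Fin.cases ?_ (fun j => ?_) i
        · rw [iteratedFDeriv_swap_zero hf, iteratedFDeriv_swap_zero hf]
          have h2 : ContDiffAt ℝ 2 (iteratedFDeriv ℝ m f) x :=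
            hf.iteratedFDeriv_right (by norm_cast; omega)
          have := h2.isSymmSndFDerivAt (by simp)
          have e0 : (v ∘ ⇑(Equiv.swap (Fin.castSucc (0 : Fin (m+1))) (Fin.succ 0))) 0 = v 1 := by
            simp
          have e1 : (v ∘ ⇑(Equiv.swap (Fin.castSucc (0 : Fin (m+1))) (Fin.succ 0))) 1 = v 0 := by
            simp
          have e2 : (fun i : Fin m =>
              (v ∘ ⇑(Equiv.swap (Fin.castSucc (0 : Fin (m+1))) (Fin.succ 0))) i.succ.succ)
              = fun i => v i.succ.succ := by
            ext1 i
            simp only [Function.comp]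
            rw [Equiv.swap_apply_of_ne_of_ne]
            · simp [Fin.ext_iff]
            · simp [Fin.ext_iff]
          rw [e0, e1, e2, this.eq]
        · have hd : DifferentiableAt ℝ (iteratedFDeriv ℝ (m + 1) f) x :=
            hf.differentiableAt_iteratedFDeriv hlt
          rw [hd.iteratedFDeriv_succ_apply_left', hd.iteratedFDeriv_succ_apply_left']
          have e0 : (v ∘ ⇑(Equiv.swap (Fin.castSucc j.succ) (Fin.succ j.succ))) 0 = v 0 := by
            simp only [Function.comp]
            rw [Equiv.swap_apply_of_ne_of_ne]
            · simp [Fin.ext_iff]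
            · simp [Fin.ext_iff]
          have et : Fin.tail (v ∘ ⇑(Equiv.swap (Fin.castSucc j.succ) (Fin.succ j.succ))) =
              Fin.tail v ∘ ⇑(Equiv.swap j.castSucc j.succ) := by
            ext1 i
            simp only [Fin.tail, Function.comp]
            congr 1
            rw [Fin.castSucc_succ]
            exact (Function.Injective.swap_apply (Fin.succ_injective _) _ _ _)
          rw [e0, et]
          congr 1
          apply Filter.EventuallyEq.fderiv_eq
          have := (hf.of_le hlt.le).eventually (by simp)
          filter_upwards [this] with y hy
          exact ih hy _ _

lemma exists_diag_ne_zero {n : ℕ} {f : E → G} {x : E}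
    (hf : ContDiffAt ℝ (n : WithTop ℕ∞) f x) (hne : iteratedFDeriv ℝ n f x ≠ 0) :
    ∃ w : E, iteratedFDeriv ℝ n f x (fun _ => w) ≠ 0 := by
  by_contra! h
  apply hne
  ext v
  have h1 := (iteratedFDeriv ℝ n f x).iteratedFDeriv_comp_diagonal 0 v
  simp only [h] at h1
  have h2 : ∀ σ : Equiv.Perm (Fin n), iteratedFDeriv ℝ n f x (fun i => v (σ i)) =
      iteratedFDeriv ℝ n f x v := fun σ => contDiffAt_symm_iteratedFDeriv n hf v σ
  simp only [h2] at h1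
  have h0 : iteratedFDeriv ℝ n (fun _ : E => (0 : G)) 0 = 0 := by
    simpa using congrFun (iteratedFDeriv_zero_fun (𝕜 := ℝ) (E := E) (F := G) (n := n)) 0
  rw [h0] at h1
  simp only [Finset.sum_const, zero_apply] at h1
  rw [← Nat.cast_smul_eq_nsmul ℝ] at h1
  have := smul_eq_zero.1 h1.symm
  rcases this with h | h
  · simp [Fintype.card_perm, Nat.factorial_ne_zero] at h
  · simpa using h

lemma taylor_littleO_vanish [CompleteSpace G] {s : ℕ} {f : E → G}
    (hf : ContDiffAt ℝ (s + 1) f 0)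
    (hvanish : ∀ i ≤ s, iteratedFDeriv ℝ i f 0 = 0) :
    (fun y => f y - ((s + 1).factorial : ℝ)⁻¹ • iteratedFDeriv ℝ (s + 1) f 0 (fun _ => y))
      =o[𝓝 0] fun y => ‖y‖ ^ (s + 1) := by
  have hcont : ContinuousAt (iteratedFDeriv ℝ (s + 1) f) 0 :=
    (hf.iteratedFDeriv_right (i := s + 1) (m := 0) (by simp)).continuousAt
  rw [isLittleO_iff]
  intro c hc
  have h1 := hf.eventually (by simp)
  have h2 := Metric.continuousAt_iff'.1 hcont c hc
  obtain ⟨δ, hδ, hball⟩ := Metric.eventually_nhds_iff_ball.1 (h1.and h2)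
  filter_upwards [Metric.ball_mem_nhds 0 hδ] with y hy
  have hmem : ∀ t ∈ Set.Icc (0 : ℝ) 1, 0 + t • y ∈ Metric.ball (0 : E) δ := by
    intro t ht
    simp only [zero_add, mem_ball_zero_iff, norm_smul, Real.norm_eq_abs, abs_of_nonneg ht.1] at *
    nlinarith [norm_nonneg y, ht.2]
  have ht := map_add_eq_sum_add_integral_iteratedFDeriv (f := f) (x := 0) (y := y) (n := s)
    (fun t ht => (hball _ (hmem t ht)).1)
  rw [Finset.sum_eq_zero, zero_add, zero_add] at ht
  swap
  · intro k hk
    rw [hvanish k (by simpa [Nat.lt_succ_iff] using hk)]; simp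
  have hint : ∫ t in (0 : ℝ)..1, (1 - t) ^ s = ((s : ℝ) + 1)⁻¹ := by
    rw [intervalIntegral.integral_comp_sub_left (fun t => t ^ s) 1]
    simp
  have hD : ((s + 1).factorial : ℝ)⁻¹ • iteratedFDeriv ℝ (s + 1) f 0 (fun _ => y) =
      (s.factorial : ℝ)⁻¹ •
        ∫ t in (0 : ℝ)..1, (1 - t) ^ s • iteratedFDeriv ℝ (s + 1) f 0 (fun _ => y) := by
    rw [intervalIntegral.integral_smul_const, hint, smul_smul, Nat.factorial_succ]
    push_cast
    rw [mul_inv, mul_comm]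
  have hc1 : ContinuousOn (fun t : ℝ => (1 - t) ^ s •
      iteratedFDeriv ℝ (s + 1) f (0 + t • y) (fun _ => y)) (Set.uIcc 0 1) := by
    rw [Set.uIcc_of_le zero_le_one]
    intro t ht
    have h_cont : ContinuousAt (iteratedFDeriv ℝ (s + 1) f) (0 + t • y) :=
      ((hball _ (hmem t ht)).1.iteratedFDeriv_right (i := s + 1) (m := 0) (by simp)).continuousAt
    have h3 := (h_cont.comp (f := fun t : ℝ => 0 + t • y) (x := t)
      (by fun_prop)).continuousWithinAt (s := Set.Icc 0 1) |>.eval_const (fun _ => y)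
    exact ContinuousWithinAt.smul (by fun_prop) h3
  have hc2 : Continuous (fun t : ℝ => (1 - t) ^ s •
      iteratedFDeriv ℝ (s + 1) f 0 (fun _ => y)) := by fun_prop
  rw [ht, hD, ← smul_sub, ← intervalIntegral.integral_sub hc1.intervalIntegrable
    (hc2.intervalIntegrable _ _), norm_smul]
  have hb : ‖∫ t in (0 : ℝ)..1, ((1 - t) ^ s • iteratedFDeriv ℝ (s + 1) f (0 + t • y) (fun _ => y)
      - (1 - t) ^ s • iteratedFDeriv ℝ (s + 1) f 0 (fun _ => y))‖ ≤
      (c * ‖y‖ ^ (s + 1)) * |1 - 0| := by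
    apply intervalIntegral.norm_integral_le_of_norm_le_const
    intro t ht
    rw [Set.uIoc_of_le zero_le_one] at ht
    have htI : t ∈ Set.Icc (0 : ℝ) 1 := ⟨ht.1.le, ht.2⟩
    rw [← smul_sub, norm_smul, ← sub_apply]
    have hle := ContinuousMultilinearMap.le_opNorm
      (iteratedFDeriv ℝ (s + 1) f (0 + t • y) - iteratedFDeriv ℝ (s + 1) f 0) (fun _ => y)
    have hd := (hball _ (hmem t htI)).2
    rw [dist_eq_norm] at hd
    simp only [Finset.prod_const, Finset.card_univ, Fintype.card_fin] at hle
    have hp : ‖(1 - t) ^ s‖ ≤ 1 := by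
      rw [norm_pow, Real.norm_eq_abs, abs_of_nonneg (by linarith [ht.2])]
      exact pow_le_one₀ (by linarith [ht.2]) (by linarith [ht.1])
    calc _ ≤ 1 * (c * ‖y‖ ^ (s + 1)) := by
          gcongr
          exact hle.trans (by gcongr)
      _ = _ := one_mul _
  have hfac : ‖(s.factorial : ℝ)⁻¹‖ ≤ 1 := by
    rw [norm_inv, Real.norm_natCast]
    exact inv_le_one_of_one_le₀ (by exact_mod_cast Nat.one_le_iff_ne_zero.2 s.factorial_ne_zero)
  rw [norm_pow, norm_norm]
  calc _ ≤ 1 * (c * ‖y‖ ^ (s + 1) * |1 - 0|) := by gcongr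
    _ = _ := by simp

end helpers

theorem exists_direction_curves_not_littleO
    (p q s : ℕ) (hp : 1 ≤ p) (hq : 1 ≤ q)
    (F : EuclideanSpace ℝ (Fin p) → EuclideanSpace ℝ (Fin q))
    (hF : ContDiffAt ℝ (s + 1) F 0) (hF0 : F 0 = 0)
    (hvanish : ∀ i ≤ s, iteratedFDeriv ℝ i F 0 = 0)
    (hne : iteratedFDeriv ℝ (s + 1) F 0 ≠ 0) :
    ∃ w : EuclideanSpace ℝ (Fin p), w ≠ 0 ∧
      ∀ (a b : ℝ), a ≠ 0 → b ≠ 0 →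
        ∀ (u ut : ℝ → EuclideanSpace ℝ (Fin p)),
          u 0 = 0 → ut 0 = 0 →
          HasDerivAt u (a • w) 0 → HasDerivAt ut (b • w) 0 →
          ¬ ((fun t => ((u t, (0 : EuclideanSpace ℝ (Fin q))) :
                EuclideanSpace ℝ (Fin p) × EuclideanSpace ℝ (Fin q)) -
              (ut t, F (ut t))) =o[𝓝 0] fun t => |t| ^ (s + 1)) := by
  have hF' : ContDiffAt ℝ ((s + 1 : ℕ) : WithTop ℕ∞) F 0 := by exact_mod_cast hF
  obtain ⟨w, hw⟩ := exists_diag_ne_zero hF' hne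
  refine ⟨w, ?_, ?_⟩
  · rintro rfl
    exact hw ((iteratedFDeriv ℝ (s + 1) F 0).map_coord_zero 0 rfl)
  intro a b _ hb u ut _ hut0 _ hut h
  have hFo : (fun t => F (ut t)) =o[𝓝 0] fun t => |t| ^ (s + 1) := by
    have := (isLittleO_prod_left.1 h).2
    simpa using this
  have hutO : ut =O[𝓝 0] fun t : ℝ => t := by
    simpa [hut0] using hut.isBigO_sub
  have htend : Tendsto ut (𝓝 0) (𝓝 0) := by
    simpa [hut0] using hut.continuousAt.tendsto
  have hT := (taylor_littleO_vanish hF hvanish).comp_tendsto htend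
  have hO : ((fun y => ‖y‖ ^ (s + 1)) ∘ ut) =O[𝓝 0] fun t : ℝ => |t| ^ (s + 1) :=
    hutO.norm_norm.pow (s + 1)
  have hD := hFo.sub (hT.trans_isBigO hO)
  simp only [Function.comp, sub_sub_cancel] at hD
  have hD2 : (fun t => iteratedFDeriv ℝ (s + 1) F 0 (fun _ => ut t)) =o[𝓝 0]
      fun t : ℝ => t ^ (s + 1) := by
    have h3 := hD.const_smul_left ((s + 1).factorial : ℝ)
    have hfac : ((s + 1).factorial : ℝ) ≠ 0 := by exact_mod_cast Nat.factorial_ne_zero _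
    refine IsLittleO.of_norm_right ?_
    have h9 : (((s + 1).factorial : ℝ) • fun x => ((s + 1).factorial : ℝ)⁻¹ •
        iteratedFDeriv ℝ (s + 1) F 0 fun _ => ut x) =
        fun t => iteratedFDeriv ℝ (s + 1) F 0 (fun _ => ut t) := by
      ext1 t
      simp only [Pi.smul_apply, smul_smul, mul_inv_cancel₀ hfac, one_smul]
    rw [h9] at h3
    simpa using h3
  have h4 := (hD2.mono (nhdsWithin_le_nhds (s := {0}ᶜ))).tendsto_inv_smul_nhds_zero
  have hslope := hasDerivAt_iff_tendsto_slope.1 hut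
  have hcm : Continuous fun y => iteratedFDeriv ℝ (s + 1) F 0 (fun _ => y) := by fun_prop
  have h5 := (hcm.tendsto (b • w)).comp hslope
  have h6 : ((fun y => iteratedFDeriv ℝ (s + 1) F 0 (fun _ => y)) ∘ slope ut 0) =
      fun t => (t ^ (s + 1))⁻¹ • iteratedFDeriv ℝ (s + 1) F 0 (fun _ => ut t) := by
    ext1 t
    have := (iteratedFDeriv ℝ (s + 1) F 0).map_smul_univ (fun _ => t⁻¹) (fun _ => ut t)
    simpa [slope, hut0] using this
  rw [h6] at h5
  have h7 := tendsto_nhds_unique h5 h4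
  have h8 := (iteratedFDeriv ℝ (s + 1) F 0).map_smul_univ (fun _ => b) (fun _ => w)
  rw [h8] at h7
  simp [hb, hw] at h7
end

section
/- Define y₋, y₊ : ℝ → ℝ by y₋(x) = x² − |x|^{5/2} and y₊(x) = x² + |x|^{5/2} (using the real power |x|^(5/2 : ℝ)). Then: (i) y₋ and y₊ are C² on ℝ; (ii) the i-th derivatives of y₋ and y₊ at 0 coincide for every i ≤ 2 (both have Taylor polynomial x² of degree 2 about 0); (iii) y₊ − y₋ = o(x²) as x → 0; and (iv) y₊ − y₋ is NOT o(|x|³) as x → 0. Hence the graphs of y₋ and y₊ (one-dimensional C² manifolds extending the two branches of the algebraic set (y − x²)² = x⁵) have at (0,0) order of tangency at least 2 but not at least 3. -/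
open Filter Asymptotics Topology

lemma aux_h (x : ℝ) : HasDerivAt (fun x : ℝ => |x| ^ ((1 : ℝ) / 2) * x)
    (3 / 2 * |x| ^ ((1 : ℝ) / 2)) x := by
  have key : ∀ y : ℝ, y ≠ 0 → HasDerivAt (fun x : ℝ => |x| ^ ((1 : ℝ) / 2) * x)
      (3 / 2 * |y| ^ ((1 : ℝ) / 2)) y := by
    intro y hy
    have h := hasDerivAt_abs_rpow y (p := 3 / 2) (by norm_num)
    have e2 : ∀ z : ℝ, z ≠ 0 → |z| ^ ((3 : ℝ) / 2) = |z| ^ ((1 : ℝ) / 2) * |z| := by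
      intro z hz
      rw [← Real.rpow_add_one (abs_ne_zero.2 hz)]
      norm_num
    have e3 : |y| ^ ((1 : ℝ) / 2) = |y| ^ ((3 : ℝ) / 2 - 2) * |y| := by
      rw [← Real.rpow_add_one (abs_ne_zero.2 hy)]
      norm_num
    rcases lt_or_gt_of_ne hy with h0 | h0
    · have h' := h.neg.congr_of_eventuallyEq (f₁ := fun x : ℝ => |x| ^ ((1 : ℝ) / 2) * x) (by
        filter_upwards [eventually_lt_nhds h0] with z hz
        simp only [Pi.neg_apply]
        rw [e2 z hz.ne, abs_of_neg hz]; ring)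
      refine h'.congr_deriv ?_
      rw [e3, abs_of_neg h0]; ring
    · have h' := h.congr_of_eventuallyEq (f₁ := fun x : ℝ => |x| ^ ((1 : ℝ) / 2) * x) (by
        filter_upwards [eventually_gt_nhds h0] with z hz
        rw [e2 z hz.ne', abs_of_pos hz])
      refine h'.congr_deriv ?_
      rw [e3, abs_of_pos h0]; ring
  have hc : Continuous fun x : ℝ => |x| ^ ((1 : ℝ) / 2) :=
    continuous_abs.rpow_const fun _ => Or.inr (by norm_num)
  by_cases hx : x = 0
  · subst hx
    exact hasDerivAt_of_hasDerivAt_of_ne (f := fun x : ℝ => |x| ^ ((1 : ℝ) / 2) * x)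
      (g := fun x : ℝ => 3 / 2 * |x| ^ ((1 : ℝ) / 2)) key
      (hc.mul continuous_id).continuousAt (continuous_const.mul hc).continuousAt
  · exact key x hx

lemma aux_d1 (c : ℝ) : deriv (fun x : ℝ => x ^ 2 + c * |x| ^ ((5 : ℝ) / 2)) =
    fun x => 2 * x + c * (5 / 2 * (|x| ^ ((1 : ℝ) / 2) * x)) := by
  funext x
  have h := (hasDerivAt_pow 2 x).add
    ((hasDerivAt_abs_rpow x (p := 5 / 2) (by norm_num)).const_mul c)
  refine HasDerivAt.deriv (h.congr_deriv ?_)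
  rw [show (5 : ℝ) / 2 - 2 = 1 / 2 by norm_num]
  push_cast
  ring

lemma aux_hd2 (c x : ℝ) :
    HasDerivAt (fun x : ℝ => 2 * x + c * (5 / 2 * (|x| ^ ((1 : ℝ) / 2) * x)))
      (2 + c * (15 / 4 * |x| ^ ((1 : ℝ) / 2))) x := by
  have h := ((hasDerivAt_id x).const_mul 2).add (((aux_h x).const_mul (5 / 2)).const_mul c)
  refine h.congr_deriv ?_
  ring

lemma aux_contDiff (c : ℝ) : ContDiff ℝ 2 (fun x : ℝ => x ^ 2 + c * |x| ^ ((5 : ℝ) / 2)) := by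
  have hc : Continuous fun x : ℝ => |x| ^ ((1 : ℝ) / 2) :=
    continuous_abs.rpow_const fun _ => Or.inr (by norm_num)
  rw [show (2 : WithTop ℕ∞) = 1 + 1 by norm_num, contDiff_succ_iff_deriv]
  refine ⟨fun x => ?_, by simp, ?_⟩
  · exact ((hasDerivAt_pow 2 x).add
      ((hasDerivAt_abs_rpow x (p := 5 / 2) (by norm_num)).const_mul c)).differentiableAt
  · rw [aux_d1, contDiff_one_iff_deriv]
    refine ⟨fun x => (aux_hd2 c x).differentiableAt, ?_⟩
    rw [funext fun x => (aux_hd2 c x).deriv]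
    fun_prop

lemma aux_iter (c : ℝ) (i : ℕ) (hi : i ≤ 2) :
    iteratedDeriv i (fun x : ℝ => x ^ 2 + c * |x| ^ ((5 : ℝ) / 2)) 0 =
      if i = 2 then 2 else 0 := by
  interval_cases i
  · simp [Real.zero_rpow]
  · rw [iteratedDeriv_one, aux_d1]; simp
  · rw [iteratedDeriv_succ, iteratedDeriv_one, aux_d1, (aux_hd2 c 0).deriv]
    simp [Real.zero_rpow]

theorem colley_kennedy_example :
    (ContDiff ℝ 2 fun x : ℝ => x ^ 2 - |x| ^ ((5 : ℝ) / 2)) ∧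
    (ContDiff ℝ 2 fun x : ℝ => x ^ 2 + |x| ^ ((5 : ℝ) / 2)) ∧
    (∀ i ≤ 2,
      iteratedDeriv i (fun x : ℝ => x ^ 2 - |x| ^ ((5 : ℝ) / 2)) 0 =
      iteratedDeriv i (fun x : ℝ => x ^ 2 + |x| ^ ((5 : ℝ) / 2)) 0) ∧
    ((fun x : ℝ => (x ^ 2 + |x| ^ ((5 : ℝ) / 2)) - (x ^ 2 - |x| ^ ((5 : ℝ) / 2)))
      =o[𝓝 0] fun x : ℝ => x ^ 2) ∧
    ¬ ((fun x : ℝ => (x ^ 2 + |x| ^ ((5 : ℝ) / 2)) - (x ^ 2 - |x| ^ ((5 : ℝ) / 2)))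
      =o[𝓝 0] fun x : ℝ => |x| ^ 3) := by
  have em : (fun x : ℝ => x ^ 2 - |x| ^ ((5 : ℝ) / 2)) =
      fun x : ℝ => x ^ 2 + (-1) * |x| ^ ((5 : ℝ) / 2) := by funext x; ring
  have ep : (fun x : ℝ => x ^ 2 + |x| ^ ((5 : ℝ) / 2)) =
      fun x : ℝ => x ^ 2 + 1 * |x| ^ ((5 : ℝ) / 2) := by funext x; ring
  have hc : Continuous fun x : ℝ => |x| ^ ((1 : ℝ) / 2) :=
    continuous_abs.rpow_const fun _ => Or.inr (by norm_num)
  have t0 : Tendsto (fun x : ℝ => |x| ^ ((1 : ℝ) / 2)) (𝓝 0) (𝓝 0) := by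
    have := hc.tendsto 0
    simpa [Real.zero_rpow] using this
  have ed : (fun x : ℝ => (x ^ 2 + |x| ^ ((5 : ℝ) / 2)) - (x ^ 2 - |x| ^ ((5 : ℝ) / 2))) =
      fun x : ℝ => (2 * |x| ^ ((1 : ℝ) / 2)) * x ^ 2 := by
    funext x
    have : |x| ^ ((5 : ℝ) / 2) = |x| ^ ((1 : ℝ) / 2) * x ^ 2 := by
      rw [← sq_abs x, ← Real.rpow_natCast |x| 2,
        ← Real.rpow_add_of_nonneg (abs_nonneg x) (by norm_num) (by norm_num)]
      norm_num
    rw [this]; ring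
  rw [ed]
  refine ⟨em ▸ aux_contDiff _, ep ▸ aux_contDiff _, fun i hi => ?_, ?_, fun h => ?_⟩
  · rw [em, ep, aux_iter _ i hi, aux_iter _ i hi]
  · have h1 : (fun x : ℝ => 2 * |x| ^ ((1 : ℝ) / 2)) =o[𝓝 0] fun _ => (1 : ℝ) := by
      rw [isLittleO_one_iff]
      simpa using t0.const_mul 2
    simpa using h1.mul_isBigO (isBigO_refl (fun x : ℝ => x ^ 2) (𝓝 0))
  · have hb := h.bound one_pos
    obtain ⟨e, he, hb⟩ := Metric.eventually_nhds_iff.1 hb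
    set x : ℝ := min (e / 2) 1 with hx
    have x0 : 0 < x := lt_min (by linarith) one_pos
    have x1 : x ≤ 1 := min_le_right _ _
    have xe : x < e := (min_le_left _ _).trans_lt (by linarith)
    have h2 := hb (y := x) (by simpa [abs_of_pos x0] using xe)
    have h3 : x ≤ x ^ ((1 : ℝ) / 2) := by
      simpa using Real.rpow_le_rpow_of_exponent_ge x0 x1 (show (1 : ℝ) / 2 ≤ 1 by norm_num)
    rw [abs_of_pos x0, Real.norm_of_nonneg (by positivity), Real.norm_of_nonneg (by positivity)] at h2
    have h4 : 0 < x ^ 2 := by positivity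
    nlinarith [mul_le_mul_of_nonneg_right h3 h4.le, pow_pos x0 3]
end

section
/- For every natural number N ≥ 1, the function x ↦ x^N + |x|^{N + 1/2} (using the real power |x|^((N : ℝ) + 1/2)) is C^N on ℝ (ContDiff ℝ N). -/
theorem contDiff_pow_add_rpow (N : ℕ) (hN : 1 ≤ N) :
    ContDiff ℝ N fun x : ℝ => x ^ N + |x| ^ ((N : ℝ) + 1 / 2) := by
  have hcos : Real.cos (((N : ℝ) + 1 / 2) * Real.pi) = 0 := by
    rw [Real.cos_eq_zero_iff]
    exact ⟨N, by push_cast; ring⟩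
  have hneg : ∀ x : ℝ, x < 0 → x ^ ((N : ℝ) + 1 / 2) = 0 := by
    intro x hx
    rw [Real.rpow_def_of_neg hx, hcos, mul_zero]
  have hp : ((N : ℝ) + 1 / 2) ≠ 0 := by positivity
  have habs : ∀ x : ℝ, |x| ^ ((N : ℝ) + 1 / 2)
      = x ^ ((N : ℝ) + 1 / 2) + (-x) ^ ((N : ℝ) + 1 / 2) := by
    intro x
    rcases lt_trichotomy x 0 with h | h | h
    · rw [hneg x h, abs_of_neg h, zero_add]
    · subst h
      rw [abs_zero, neg_zero, Real.zero_rpow hp, add_zero]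
    · rw [hneg (-x) (by linarith), abs_of_pos h, add_zero]
  have hc : ContDiff ℝ N fun x : ℝ => x ^ ((N : ℝ) + 1 / 2) :=
    Real.contDiff_rpow_const_of_le (by linarith)
  simp only [habs]
  exact (contDiff_id.pow N).add (hc.add (hc.comp contDiff_neg))
end

section
/- Let N ≥ 1 be a natural number and define y₋, y₊ : ℝ → ℝ by y₋(x) = x^N − |x|^{N + 1/2} and y₊(x) = x^N + |x|^{N + 1/2}. Then: (i) y₊ − y₋ = o(|x|^N) as x → 0; (ii) y₊ − y₋ is NOT o(|x|^{N+1}) as x → 0; and (iii) sSup {α : ℝ | 0 < α ∧ (fun x => y₊ x − y₋ x) =o[𝓝 0] (fun x => |x| ^ α)} = N + 1/2. Thus the pair of C^N graphs arising from (y − x^N)² = x^{2N+1} has order of tangency at least N but not at least N+1 at the origin, and minimal regular separation exponent N + 1/2. -/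
open Filter Asymptotics Topology

lemma abs_rpow_isLittleO_iff {a b : ℝ} (ha : 0 < a) (hb : 0 < b) :
    (fun x : ℝ => |x| ^ b) =o[𝓝 0] (fun x : ℝ => |x| ^ a) ↔ a < b := by
  constructor
  · intro h
    by_contra! hab
    have hO : (fun x : ℝ => |x| ^ a) =O[𝓝 0] (fun x : ℝ => |x| ^ b) := by
      apply IsBigO.of_bound 1
      filter_upwards [Metric.ball_mem_nhds (0 : ℝ) one_pos] with x hx
      have hx1 : |x| < 1 := by simpa using hx
      rw [Real.norm_of_nonneg (by positivity), Real.norm_of_nonneg (by positivity), one_mul]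
      exact Real.rpow_le_rpow_of_exponent_ge' (abs_nonneg x) hx1.le hb.le hab
    refine isLittleO_irrefl ?_ (h.trans_isBigO hO)
    have h1 : ∃ᶠ x in 𝓝[≠] (0 : ℝ), |x| ^ b ≠ 0 := by
      apply Eventually.frequently
      filter_upwards [self_mem_nhdsWithin] with x hx
      have : 0 < |x| := abs_pos.mpr hx
      positivity
    exact h1.filter_mono nhdsWithin_le_nhds
  · intro hab
    have h1 : Tendsto (fun x : ℝ => |x| ^ (b - a)) (𝓝 0) (𝓝 0) := by
      have hc : Continuous (fun x : ℝ => |x| ^ (b - a)) :=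
        continuous_abs.rpow_const (fun _ => Or.inr (by linarith))
      have := hc.tendsto 0
      simpa [Real.zero_rpow (sub_pos.mpr hab).ne'] using this
    have h2 := ((isLittleO_one_iff ℝ).mpr h1).mul_isBigO
      (isBigO_refl (fun x : ℝ => |x| ^ a) (𝓝 0))
    refine (h2.congr (fun x => ?_) (fun x => one_mul _))
    rw [← Real.rpow_add_of_nonneg (abs_nonneg x) (by linarith) ha.le, sub_add_cancel]

theorem generalized_colley_kennedy (N : ℕ) (hN : 1 ≤ N) :
    ((fun x : ℝ => (x ^ N + |x| ^ ((N : ℝ) + 1 / 2)) - (x ^ N - |x| ^ ((N : ℝ) + 1 / 2)))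
      =o[𝓝 0] fun x : ℝ => |x| ^ N) ∧
    ¬ ((fun x : ℝ => (x ^ N + |x| ^ ((N : ℝ) + 1 / 2)) - (x ^ N - |x| ^ ((N : ℝ) + 1 / 2)))
      =o[𝓝 0] fun x : ℝ => |x| ^ (N + 1)) ∧
    sSup {α : ℝ | 0 < α ∧
      (fun x : ℝ => (x ^ N + |x| ^ ((N : ℝ) + 1 / 2)) - (x ^ N - |x| ^ ((N : ℝ) + 1 / 2)))
        =o[𝓝 0] fun x : ℝ => |x| ^ α} = (N : ℝ) + 1 / 2 := by
  have hN' : (1 : ℝ) ≤ N := by exact_mod_cast hN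
  have hf : (fun x : ℝ => (x ^ N + |x| ^ ((N : ℝ) + 1 / 2)) - (x ^ N - |x| ^ ((N : ℝ) + 1 / 2)))
      = fun x : ℝ => 2 * |x| ^ ((N : ℝ) + 1 / 2) := by
    funext x; ring
  have key : ∀ a : ℝ, 0 < a → ((fun x : ℝ => 2 * |x| ^ ((N : ℝ) + 1 / 2)) =o[𝓝 0]
      (fun x : ℝ => |x| ^ a) ↔ a < (N : ℝ) + 1 / 2) := by
    intro a ha
    rw [isLittleO_const_mul_left_iff (two_ne_zero)]
    exact abs_rpow_isLittleO_iff ha (by linarith)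
  rw [hf]
  refine ⟨?_, ?_, ?_⟩
  · have := (key N (by linarith)).2 (by linarith)
    simpa only [Real.rpow_natCast] using this
  · intro h
    have h2 := (key ((N + 1 : ℕ) : ℝ) (by positivity)).1
      (by simpa only [Real.rpow_natCast] using h)
    push_cast at h2
    linarith
  · have hs : {α : ℝ | 0 < α ∧ (fun x : ℝ => 2 * |x| ^ ((N : ℝ) + 1 / 2)) =o[𝓝 0]
        fun x : ℝ => |x| ^ α} = Set.Ioo 0 ((N : ℝ) + 1 / 2) := by
      ext a
      exact and_congr_right (key a)
    rw [hs]
    exact csSup_Ioo (by linarith)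
end

section
/- There exist ε > 0 and a function y : ℝ → ℝ, continuous on (−ε, ε), with y(0) = 0, such that: (i) for every x ∈ (−ε, ε), the point (x, y(x)) lies on the quatrefoil, i.e. (x · y(x))² = (1/4) · (x² + y(x)²)³; (ii) y(x) − x²/2 = o(x²) as x → 0. Consequently, the two branches of the quatrefoil tangent to the x-axis at the origin are the graphs of y and −y (note −y also satisfies the equation), and their minimal regular separation exponent at (0,0) equals 2: sSup {α : ℝ | 0 < α ∧ (fun x => 2 · y x) =o[𝓝 0] (fun x => |x| ^ α)} = 2. -/
open Filter Asymptotics Topology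

lemma inv_exists : ∃ ε > (0 : ℝ), ∃ g : ℝ → ℝ, ContinuousOn g (Set.Ioo (-ε) ε) ∧ g 0 = 0 ∧
    HasDerivAt g (1/2) 0 ∧
    ∀ x ∈ Set.Ioo (-ε) ε, 2 * g x / (√(1 + g x ^ 2)) ^ 3 = x := by
  let f : ℝ → ℝ := fun t => 2 * t / (√(1 + t ^ 2)) ^ 3
  have hc : ContDiffAt ℝ 1 f 0 := by
    have h1 : ContDiffAt ℝ 1 (fun t : ℝ => √(1 + t ^ 2)) 0 :=
      ContDiffAt.sqrt (by fun_prop) (by norm_num)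
    exact ContDiffAt.div (by fun_prop) (h1.pow 3) (by norm_num)
  have hd : HasDerivAt f 2 0 := by
    have h0 : HasDerivAt (fun t : ℝ => 1 + t ^ 2) 0 0 := by
      simpa using ((hasDerivAt_id (0:ℝ)).pow 2).const_add 1
    have h1 : HasDerivAt (fun t : ℝ => √(1 + t ^ 2)) 0 0 := by
      simpa using h0.sqrt (by norm_num)
    have h2 := (((hasDerivAt_id (0:ℝ)).const_mul 2).fun_div (h1.fun_pow 3) (by norm_num))
    have h3 : ∀ c : ℝ, HasDerivAt f c 0 → c = 2 → HasDerivAt f 2 0 := fun c h hc => hc ▸ h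
    exact h3 _ h2 (by norm_num)
  have hs : HasStrictDerivAt f 2 0 := by
    have := hc.hasStrictDerivAt (by norm_num)
    rwa [hd.deriv] at this
  have hs' := hs.hasStrictFDerivAt_equiv (two_ne_zero)
  have f0 : f 0 = 0 := by simp [f]
  let e := hs'.toOpenPartialHomeomorph f
  have hm : (0:ℝ) ∈ e.target := by
    have := hs'.image_mem_toOpenPartialHomeomorph_target
    rwa [f0] at this
  obtain ⟨ε, hε, hb⟩ := Metric.isOpen_iff.1 e.open_target 0 hm
  rw [Real.ball_eq_Ioo, zero_sub, zero_add] at hb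
  refine ⟨ε, hε, e.symm, e.continuousOn_symm.mono hb, ?_, ?_, fun x hx => e.right_inv (hb hx)⟩
  · have := e.left_inv hs'.mem_toOpenPartialHomeomorph_source
    have h2 : e 0 = 0 := f0
    rwa [h2] at this
  · have := (hs.to_localInverse two_ne_zero).hasDerivAt
    rw [f0] at this
    simpa [HasStrictDerivAt.localInverse, HasStrictFDerivAt.localInverse] using this

theorem quatrefoil_branches :
    ∃ ε > (0 : ℝ), ∃ y : ℝ → ℝ,
      ContinuousOn y (Set.Ioo (-ε) ε) ∧ y 0 = 0 ∧
      (∀ x ∈ Set.Ioo (-ε) ε,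
        (x * y x) ^ 2 = (1 / 4) * (x ^ 2 + y x ^ 2) ^ 3) ∧
      ((fun x : ℝ => y x - x ^ 2 / 2) =o[𝓝 0] fun x : ℝ => x ^ 2) ∧
      sSup {α : ℝ | 0 < α ∧
        (fun x : ℝ => 2 * y x) =o[𝓝 0] fun x : ℝ => |x| ^ α} = 2 := by
  obtain ⟨ε, hε, g, hg, g0, gd, hx⟩ := inv_exists
  have ho : (fun x : ℝ => x * g x - x ^ 2 / 2) =o[𝓝 0] fun x : ℝ => x ^ 2 := by
    have h1 := hasDerivAt_iff_isLittleO.1 gd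
    have h2 := (isBigO_refl (fun x : ℝ => x) (𝓝 0)).mul_isLittleO h1
    refine h2.congr (fun x => ?_) (fun x => ?_)
    · simp [g0]; ring
    · simp; ring
  refine ⟨ε, hε, fun x => x * g x, continuousOn_id.mul hg, by simp, ?_, ho, ?_⟩
  · intro x hxx
    have h := hx x hxx
    set t := g x
    have hp : 0 < 1 + t ^ 2 := by positivity
    have hs : 0 < √(1 + t ^ 2) := Real.sqrt_pos.2 hp
    have hq : √(1 + t ^ 2) ^ 2 = 1 + t ^ 2 := Real.sq_sqrt hp.le
    rw [div_eq_iff (by positivity)] at h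
    have h4 : 4 * t ^ 2 = x ^ 2 * (1 + t ^ 2) ^ 3 := by
      rw [← hq]; linear_combination (2 * t + x * √(1 + t ^ 2) ^ 3) * h
    dsimp only
    linear_combination x ^ 4 / 4 * h4
  · have hset : {α : ℝ | 0 < α ∧
        (fun x : ℝ => 2 * (x * g x)) =o[𝓝 0] fun x : ℝ => |x| ^ α} = Set.Ioo 0 2 := by
      ext α
      simp only [Set.mem_ofPred_eq, Set.mem_Ioo]
      refine and_congr_right fun hα => ⟨fun h => ?_, fun h => ?_⟩
      · by_contra hcon
        push Not at hcon
        have hO : (fun x : ℝ => |x| ^ α) =O[𝓝 0] fun x : ℝ => x ^ 2 := by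
          refine IsBigO.of_bound 1 ?_
          filter_upwards [Metric.ball_mem_nhds (0:ℝ) one_pos] with x hx1
          have hx1 : |x| < 1 := by simpa using hx1
          rw [one_mul, Real.norm_of_nonneg (by positivity), Real.norm_of_nonneg (by positivity),
            ← sq_abs, ← Real.rpow_natCast]
          rcases (abs_nonneg x).eq_or_lt with h0 | h0
          · rw [← h0, Real.zero_rpow hα.ne']; positivity
          · exact Real.rpow_le_rpow_of_exponent_ge h0 hx1.le (by simpa using hcon)
        have h3 := (h.trans_isBigO hO).sub (ho.const_mul_left 2)
        have h4 : (fun x : ℝ => x ^ 2) =o[𝓝 0] fun x : ℝ => x ^ 2 :=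
          h3.congr_left fun x => by ring
        have h5 := isLittleO_irrefl' (l := 𝓝[≠] (0:ℝ)) (f' := fun x : ℝ => x ^ 2) ?_
        · exact h5 (h4.mono nhdsWithin_le_nhds)
        · refine Eventually.frequently ?_
          filter_upwards [self_mem_nhdsWithin] with x hx
          have hx : x ≠ 0 := hx
          simpa using hx
      · have hO : (fun x : ℝ => 2 * (x * g x)) =O[𝓝 0] fun x : ℝ => x ^ 2 :=
          ((ho.isBigO.const_mul_left 2).add (isBigO_refl _ _)).congr_left fun x => by ring
        refine hO.trans_isLittleO ?_
        have h1 : (fun x : ℝ => |x| ^ (2 - α)) =o[𝓝 0] fun _ : ℝ => (1:ℝ) := by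
          rw [isLittleO_one_iff]
          have : ContinuousAt (fun x : ℝ => |x| ^ (2 - α)) 0 :=
            continuousAt_id.abs.rpow_const (Or.inr (by linarith))
          have h2 := this.tendsto
          simpa [Real.zero_rpow (show 2 - α ≠ 0 by linarith)] using h2
        have h2 := h1.mul_isBigO (isBigO_refl (fun x : ℝ => |x| ^ α) (𝓝 0))
        refine h2.congr (fun x => ?_) (fun x => one_mul _)
        rw [← Real.rpow_add' (abs_nonneg x) (by norm_num)]
        norm_num
    rw [hset, csSup_Ioo two_pos]
end

section
/- There exist ε > 0 and a function y : ℝ → ℝ, continuous on [−ε, 0], with y(0) = 0 and y(x) ≥ 0 on [−ε, 0], such that: (i) for every x ∈ [−ε, 0], the point (x, y(x)) lies on the cardioid, i.e. (x² + y(x)² − x/2)² = (1/4) · (x² + y(x)²); (ii) y(x) − 2(−x)^{3/2} = o((−x)^{3/2}) as x → 0 from the left (along the filter 𝓝[≤] 0). Consequently, the two branches {y ≥ 0} and {y ≤ 0} of the cardioid meeting at the origin are the graphs of y and −y, and their minimal regular separation exponent at (0,0) equals 3/2: sSup {α : ℝ | 0 < α ∧ (fun x => 2 · y x) =o[𝓝[Set.Iic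 0] 0] (fun x => |x| ^ α)} = 3/2. -/
open Filter Asymptotics Topology

theorem cardioid_branches :
    ∃ ε > (0 : ℝ), ∃ y : ℝ → ℝ,
      ContinuousOn y (Set.Icc (-ε) 0) ∧ y 0 = 0 ∧
      (∀ x ∈ Set.Icc (-ε) 0, 0 ≤ y x) ∧
      (∀ x ∈ Set.Icc (-ε) 0,
        (x ^ 2 + y x ^ 2 - x / 2) ^ 2 = (1 / 4) * (x ^ 2 + y x ^ 2)) ∧
      ((fun x : ℝ => y x - 2 * (-x) ^ ((3 : ℝ) / 2)) =o[𝓝[Set.Iic 0] 0]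
        fun x : ℝ => (-x) ^ ((3 : ℝ) / 2)) ∧
      sSup {α : ℝ | 0 < α ∧
        (fun x : ℝ => 2 * y x) =o[𝓝[Set.Iic 0] 0] fun x : ℝ => |x| ^ α} = 3 / 2 := by
  obtain ⟨D, hDdef⟩ : ∃ D : ℝ → ℝ, D = fun x => √(1 / 16 + x / 2) := ⟨_, rfl⟩
  have hDc : Continuous D := by rw [hDdef]; fun_prop
  have hD0 : ∀ x, 0 ≤ D x := fun x => by rw [hDdef]; positivity
  have hDsq : ∀ x ∈ Set.Icc (-(1 / 8) : ℝ) 0, D x ^ 2 = 1 / 16 + x / 2 := by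
    intro x hx
    rw [hDdef]
    exact Real.sq_sqrt (by linarith [hx.1])
  have hDz : D 0 = 1 / 4 := by
    have h1 := hDsq 0 (by norm_num)
    nlinarith [hD0 0]
  obtain ⟨g, hg⟩ : ∃ g : ℝ → ℝ, g = fun x =>
      √((2 + 1 / (1 / 4 + D x)) / (2 * (1 / 4 + x + D x))) := ⟨_, rfl⟩
  have hgc : ContinuousOn g (Set.Icc (-(1 / 8) : ℝ) 0) := by
    rw [hg]
    apply ContinuousOn.sqrt
    apply ContinuousOn.div
    · apply ContinuousOn.add continuousOn_const
      apply ContinuousOn.div continuousOn_const (by fun_prop)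
      intro x _
      have := hD0 x
      positivity
    · fun_prop
    · intro x hx
      have := hD0 x
      have := hx.1
      apply ne_of_gt
      linarith
  have hg0 : ∀ x, 0 ≤ g x := fun x => by rw [hg]; positivity
  have hgz : g 0 = 2 := by
    rw [hg]
    simp only [hDz]
    rw [show ((2 + 1 / (1 / 4 + 1 / 4)) / (2 * (1 / 4 + 0 + 1 / 4)) : ℝ) = 2 ^ 2 by norm_num]
    exact Real.sqrt_sq (by norm_num)
  have hgt : Tendsto g (𝓝[Set.Iic 0] 0) (𝓝 2) := by
    have h1 := hgc 0 (by norm_num)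
    rw [ContinuousWithinAt, hgz] at h1
    rwa [nhdsWithin_Icc_eq_nhdsLE (by norm_num : (-(1 / 8) : ℝ) < 0)] at h1
  have hpow : Continuous fun x : ℝ => (-x) ^ ((3 : ℝ) / 2) :=
    continuous_neg.rpow_const (fun x => Or.inr (by norm_num))
  have hii : (fun x : ℝ => (-x) ^ ((3 : ℝ) / 2) * g x - 2 * (-x) ^ ((3 : ℝ) / 2))
      =o[𝓝[Set.Iic 0] 0] fun x : ℝ => (-x) ^ ((3 : ℝ) / 2) := by
    have h1 : (fun x => g x - 2) =o[𝓝[Set.Iic 0] 0] (fun _ => (1 : ℝ)) := by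
      rw [isLittleO_one_iff]
      simpa using hgt.sub_const 2
    have h2 := (isBigO_refl (fun x : ℝ => (-x) ^ ((3 : ℝ) / 2)) (𝓝[Set.Iic 0] 0)).mul_isLittleO h1
    refine (h2.congr (fun x => by ring) (fun x => by ring))
  refine ⟨1 / 8, by norm_num, fun x => (-x) ^ ((3 : ℝ) / 2) * g x,
    hpow.continuousOn.mul hgc, ?_, ?_, ?_, hii, ?_⟩
  · simp
  · intro x hx
    have : 0 ≤ -x := by linarith [hx.2]
    have := hg0 x
    positivity
  · intro x hx
    have ht : 0 ≤ -x := by linarith [hx.2]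
    have e1 : ((-x) ^ ((3 : ℝ) / 2)) ^ 2 = (-x) ^ 3 := by
      rw [← Real.rpow_natCast, ← Real.rpow_mul ht, ← Real.rpow_natCast]
      norm_num
    have hd := hD0 x
    have p1 : 0 < 1 / 4 + D x := by positivity
    have p2 : 0 < 1 / 4 + x + D x := by linarith [hx.1]
    have e2 : g x ^ 2 = (2 + 1 / (1 / 4 + D x)) / (2 * (1 / 4 + x + D x)) := by
      rw [hg]
      exact Real.sq_sqrt (by positivity)
    have hs := hDsq x hx
    have key : x ^ 2 + ((-x) ^ ((3 : ℝ) / 2) * g x) ^ 2 = (1 / 4 + x - D x) / 2 := by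
      rw [mul_pow, e1, e2]
      have hxx : x = 2 * (D x ^ 2 - 1 / 16) := by linarith
      generalize D x = d at *
      have q1 : (1 / 4 + d) ≠ 0 := p1.ne'
      have q2 : (1 / 4 + x + d) ≠ 0 := p2.ne'
      have : (2 + 1 / (1 / 4 + d)) / (2 * (1 / 4 + x + d))
          = (2 * (1 / 4 + d) + 1) / ((1 / 4 + d) * (2 * (1 / 4 + x + d))) := by
        field_simp
      rw [this, mul_div_assoc', ← sub_eq_zero]
      have r : x ^ 2 + (-x) ^ 3 * (2 * (1 / 4 + d) + 1) / ((1 / 4 + d) * (2 * (1 / 4 + x + d)))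
          - (1 / 4 + x - d) / 2 = (x ^ 2 * ((1 / 4 + d) * (2 * (1 / 4 + x + d)))
          + (-x) ^ 3 * (2 * (1 / 4 + d) + 1)
          - (1 / 4 + x - d) / 2 * ((1 / 4 + d) * (2 * (1 / 4 + x + d))))
            / ((1 / 4 + d) * (2 * (1 / 4 + x + d))) := by
        rw [eq_div_iff (by positivity), sub_mul, add_mul, div_mul_cancel₀ _ (by positivity)]
      rw [r, div_eq_zero_iff]
      left
      rw [hxx]
      ring
    simp only [key]
    nlinarith [hs]
  · have hne : ∃ᶠ x in 𝓝[Set.Iic (0 : ℝ)] 0, (-x) ^ ((3 : ℝ) / 2) ≠ 0 := by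
      have h1 : ∀ᶠ x in 𝓝[Set.Iio (0 : ℝ)] 0, (-x) ^ ((3 : ℝ) / 2) ≠ 0 := by
        filter_upwards [self_mem_nhdsWithin] with x hx
        exact (Real.rpow_pos_of_pos (by simpa using hx) _).ne'
      exact h1.frequently.filter_mono (nhdsWithin_mono _ Set.Iio_subset_Iic_self)
    have hset : {α : ℝ | 0 < α ∧ (fun x : ℝ => 2 * ((-x) ^ ((3 : ℝ) / 2) * g x))
        =o[𝓝[Set.Iic 0] 0] fun x : ℝ => |x| ^ α} = Set.Ioo 0 (3 / 2) := by
      ext α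
      simp only [Set.mem_ofPred_eq, Set.mem_Ioo]
      refine and_congr_right fun hα => ⟨fun h => ?_, fun h => ?_⟩
      · by_contra hcon
        push Not at hcon
        have hO : (fun x : ℝ => |x| ^ α) =O[𝓝[Set.Iic 0] 0]
            fun x : ℝ => (-x) ^ ((3 : ℝ) / 2) := by
          apply IsBigO.of_bound 1
          filter_upwards [self_mem_nhdsWithin,
            mem_nhdsWithin_of_mem_nhds (Ioi_mem_nhds (show (-1 : ℝ) < 0 by norm_num))]
            with x hx hx1
          simp only [Set.mem_Iic, Set.mem_Ioi] at hx hx1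
          have hx' : 0 ≤ -x := by linarith
          rw [abs_of_nonpos hx, one_mul, Real.norm_of_nonneg (by positivity),
            Real.norm_of_nonneg (by positivity)]
          exact Real.rpow_le_rpow_of_exponent_ge_of_imp hx' (by linarith) hcon
            (fun _ h => absurd h hα.ne')
        have h1 := h.trans_isBigO hO
        have h2 := h1.sub (hii.const_mul_left 2)
        have h3 : (fun x : ℝ => (-x) ^ ((3 : ℝ) / 2)) =o[𝓝[Set.Iic 0] 0]
            fun x : ℝ => (-x) ^ ((3 : ℝ) / 2) :=
          (h2.const_mul_left (1 / 4)).congr_left (fun x => by ring)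
        exact isLittleO_irrefl hne h3
      · have hgO : (fun x => 2 * g x) =O[𝓝[Set.Iic 0] 0] (fun _ => (1 : ℝ)) :=
          (hgt.const_mul 2).isBigO_one ℝ
        have ho : (fun x : ℝ => (-x) ^ (3 / 2 - α)) =o[𝓝[Set.Iic 0] 0] (fun _ => (1 : ℝ)) := by
          rw [isLittleO_one_iff]
          have hc : Continuous fun x : ℝ => (-x) ^ (3 / 2 - α) :=
            continuous_neg.rpow_const (fun x => Or.inr (by linarith))
          have := hc.tendsto 0
          simp only [neg_zero, Real.zero_rpow (by linarith : 3 / 2 - α ≠ 0)] at this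
          exact this.mono_left nhdsWithin_le_nhds
        have h1 := ((isBigO_refl (fun x : ℝ => |x| ^ α) (𝓝[Set.Iic 0] 0)).mul_isLittleO ho).mul_isBigO hgO
        refine h1.congr' ?_ (by simp)
        filter_upwards [self_mem_nhdsWithin] with x hx
        simp only [Set.mem_Iic] at hx
        have hx' : 0 ≤ -x := by linarith
        rw [abs_of_nonpos hx, ← Real.rpow_add_of_nonneg hx' hα.le (by linarith)]
        rw [show α + (3 / 2 - α) = 3 / 2 by ring]
        ring
    rw [hset]
    exact csSup_Ioo (by norm_num)
end

section
/- Let d, s be natural numbers with 1 < d < s and d odd. Then there exist ε > 0 and a function y : ℝ → ℝ which is C^∞ on (−ε, ε), with y(0) = 0, such that for every x ∈ (−ε, ε) one has y(x)^d + y(x) · x^{d−1} + x^s = 0, and moreover y(x) + x^{s−d+1} = o(|x|^{s−d+1}) as x → 0. -/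
open Filter Asymptotics Topology

theorem local_inv_aux (d : ℕ) (hd : 1 < d) :
    ∃ g : ℝ → ℝ, g 0 = 0 ∧ (∀ᶠ u in 𝓝 (0 : ℝ), ContDiffAt ℝ (⊤ : ℕ∞) g u) ∧
      (∀ᶠ u in 𝓝 (0 : ℝ), g u ^ d + g u = u) ∧
      ((fun u : ℝ => g u - u) =o[𝓝 0] fun u : ℝ => u) := by
  let f : ℝ → ℝ := fun z => z ^ d + z
  have hf0 : f 0 = 0 := by
    show (0 : ℝ) ^ d + 0 = 0
    rw [zero_pow (by omega), add_zero]
  have hfc : ContDiffAt ℝ (⊤ : WithTop ℕ∞) f 0 := by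
    apply ContDiff.contDiffAt
    fun_prop
  have hfd : HasDerivAt f 1 0 := by
    have h := (hasDerivAt_pow d (0 : ℝ)).add (hasDerivAt_id (0 : ℝ))
    rw [zero_pow (by omega), mul_zero, zero_add] at h
    exact h
  have hf' : HasFDerivAt f ((ContinuousLinearEquiv.refl ℝ ℝ : ℝ ≃L[ℝ] ℝ) : ℝ →L[ℝ] ℝ) 0 := by
    convert! hfd.hasFDerivAt using 1
    ext
    simp
  have hs := hfc.hasStrictFDerivAt' hf' (by simp)
  have hg0 := hfc.localInverse_apply_image hf' (by simp)
  have hgc := hfc.to_localInverse hf' (by simp)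
  have hgr := hs.eventually_right_inverse
  have hgd := hs.to_localInverse.hasFDerivAt
  rw [hf0] at hg0 hgc hgr hgd
  refine ⟨hfc.localInverse hf' (by simp), hg0, ?_, hgr, ?_⟩
  · exact (hgc.eventually (by simp)).mono fun u hu => hu.of_le le_top
  · have h := hgd.isLittleO
    have e : hs.localInverse f _ 0 0 = 0 := hg0
    simp only [e, sub_zero] at h
    exact h

theorem tworzewski_branch (d s : ℕ) (hd : 1 < d) (hds : d < s) (hodd : Odd d) :
    ∃ ε > (0 : ℝ), ∃ y : ℝ → ℝ,
      ContDiffOn ℝ (⊤ : ℕ∞) y (Set.Ioo (-ε) ε) ∧ y 0 = 0 ∧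
      (∀ x ∈ Set.Ioo (-ε) ε, y x ^ d + y x * x ^ (d - 1) + x ^ s = 0) ∧
      ((fun x : ℝ => y x + x ^ (s - d + 1)) =o[𝓝 0]
        fun x : ℝ => |x| ^ (s - d + 1)) := by
  obtain ⟨g, hg0, hgc, hge, hgo⟩ := local_inv_aux d hd
  have ht : Tendsto (fun x : ℝ => -x ^ (s - d)) (𝓝 0) (𝓝 0) := by
    have : Continuous (fun x : ℝ => -x ^ (s - d)) := by fun_prop
    have h := this.tendsto 0
    rwa [zero_pow (by omega), neg_zero] at h
  obtain ⟨ε, hε, hb⟩ := Metric.eventually_nhds_iff.1 ((ht.eventually hgc).and (ht.eventually hge))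
  have hb' : ∀ x ∈ Set.Ioo (-ε) ε, ContDiffAt ℝ (⊤ : ℕ∞) g (-x ^ (s - d)) ∧
      g (-x ^ (s - d)) ^ d + g (-x ^ (s - d)) = -x ^ (s - d) := fun x hx => by
    apply hb
    rw [Real.dist_eq, sub_zero]
    exact abs_lt.2 hx
  refine ⟨ε, hε, fun x => x * g (-x ^ (s - d)), ?_, by simp, ?_, ?_⟩
  · intro x hx
    have h1 : ContDiffAt ℝ (⊤ : ℕ∞) (fun x : ℝ => -x ^ (s - d)) x := by fun_prop
    exact (contDiffAt_id.mul ((hb' x hx).1.comp x h1)).contDiffWithinAt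
  · intro x hx
    have h := (hb' x hx).2
    obtain ⟨k, rfl⟩ : ∃ k, s = d + k := ⟨s - d, by omega⟩
    obtain ⟨m, rfl⟩ : ∃ m, d = m + 1 := ⟨d - 1, by omega⟩
    simp only [Nat.add_sub_cancel_left, Nat.add_sub_cancel] at h ⊢
    generalize g (-x ^ k) = z at h
    rw [mul_pow]
    linear_combination x ^ (m + 1) * h
  · have h := (isBigO_refl (fun x : ℝ => x) (𝓝 0)).mul_isLittleO (hgo.comp_tendsto ht)
    rw [← isLittleO_norm_right] at h
    refine h.congr (fun x => ?_) (fun x => ?_)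
    · simp only [Function.comp]; ring
    · simp only [Function.comp, norm_mul, norm_neg, norm_pow, Real.norm_eq_abs]; ring
end

section
/- Let d, s be natural numbers with 1 < d < s and d odd, let ε > 0, and let y : ℝ → ℝ satisfy y(x)^d + y(x) · x^{d−1} + x^s = 0 for all x ∈ (−ε, ε). Then: (i) y(x) = o(|x|^{s−d}) as x → 0; (ii) y(x) is NOT o(|x|^{s−d+1}) as x → 0; and (iii) sSup {α : ℝ | 0 < α ∧ (fun x => y x) =o[𝓝 0] (fun x => |x| ^ α)} = s − d + 1. Thus the curve Z = {y^d + y x^{d−1} + x^s = 0} and the line N = {y = 0} have at (0,0) order of tangency at least s − d but not at least s − d + 1, while their minimal regular separation exponent at (0,0) is s − d + 1. -/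
open Filter Asymptotics Topology

theorem tworzewski_bounds (d s : ℕ) (hd : 1 < d) (hds : d < s)
    (hodd : Odd d) (x z : ℝ) (hx : |x| < 1) (h : z ^ d + z * x ^ (d - 1) + x ^ s = 0) :
    |z| ≤ |x| ^ (s - d + 1) ∧ |x| ^ (s - d + 1) ≤ 2 * |z| := by
  obtain ⟨k, hk⟩ := hodd
  obtain ⟨n, rfl⟩ : ∃ n, s = d + n + 1 := ⟨s - d - 1, by omega⟩
  have e1 : d - 1 = 2 * k := by omega
  have e2 : d + n + 1 - d + 1 = n + 2 := by omega
  rw [e1] at h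
  rw [e2]
  subst hk
  have hk : k ≠ 0 := by omega
  have hxe : x ^ (2 * k) = |x| ^ (2 * k) := by rw [pow_mul, pow_mul, sq_abs]
  have hze : z ^ (2 * k) = |z| ^ (2 * k) := by rw [pow_mul, pow_mul, sq_abs]
  have key : |z| * (|z| ^ (2 * k) + |x| ^ (2 * k)) = |x| ^ (n + 2) * |x| ^ (2 * k) := by
    have h1 : z * (z ^ (2 * k) + x ^ (2 * k)) = - x ^ (2 * k + 1 + n + 1) := by
      linear_combination h
    have h2 := congrArg abs h1
    rw [abs_mul, abs_neg, abs_pow, hxe, hze, abs_of_nonneg (a := _ + _) (by positivity)] at h2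
    rw [h2]; ring
  have ha := abs_nonneg z
  have ht := abs_nonneg x
  generalize |z| = a at *
  generalize |x| = t at *
  rcases ht.eq_or_lt with rfl | ht
  · have : a = 0 := by
      have : a ^ (2 * k + 1) = 0 := by
        have h0 : (0:ℝ) ^ (2 * k) = 0 := zero_pow (by omega)
        rw [h0] at key
        linear_combination key
      exact pow_eq_zero_iff (by omega) |>.1 this
    subst this; simp
  have hp : 0 < t ^ (2 * k) := by positivity
  have hq : 0 ≤ a ^ (2 * k) := by positivity
  have h1 : a ≤ t ^ (n + 2) := by
    refine le_of_mul_le_mul_right ?_ hp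
    nlinarith [mul_nonneg ha hq]
  refine ⟨h1, ?_⟩
  have h2 : a ≤ t := h1.trans (pow_le_of_le_one ht.le hx.le (by omega))
  have h3 : a ^ (2 * k) ≤ t ^ (2 * k) := pow_le_pow_left₀ ha h2 _
  refine le_of_mul_le_mul_right ?_ hp
  nlinarith [mul_le_mul_of_nonneg_left h3 ha]

theorem tworzewski_tangency_and_exponent (d s : ℕ) (hd : 1 < d) (hds : d < s)
    (hodd : Odd d) (ε : ℝ) (hε : 0 < ε) (y : ℝ → ℝ)
    (hy : ∀ x ∈ Set.Ioo (-ε) ε, y x ^ d + y x * x ^ (d - 1) + x ^ s = 0) :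
    ((fun x : ℝ => y x) =o[𝓝 0] fun x : ℝ => |x| ^ (s - d)) ∧
    ¬ ((fun x : ℝ => y x) =o[𝓝 0] fun x : ℝ => |x| ^ (s - d + 1)) ∧
    sSup {α : ℝ | 0 < α ∧
      (fun x : ℝ => y x) =o[𝓝 0] fun x : ℝ => |x| ^ α} = (s : ℝ) - d + 1 := by
  have h1 : ∀ᶠ x : ℝ in 𝓝 0, |x| < 1 :=
    (continuous_abs.tendsto' (0:ℝ) 0 abs_zero).eventually (gt_mem_nhds one_pos)
  have hb : ∀ᶠ x : ℝ in 𝓝 0,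
      |y x| ≤ |x| ^ (s - d + 1) ∧ |x| ^ (s - d + 1) ≤ 2 * |y x| := by
    filter_upwards [h1, Ioo_mem_nhds (neg_lt_zero.2 hε) hε] with x hx hx'
    exact tworzewski_bounds d s hd hds hodd x (y x) hx (hy x hx')
  have hcast : (s : ℝ) - d + 1 = ((s - d + 1 : ℕ) : ℝ) := by
    push_cast [Nat.cast_sub hds.le]; ring
  have hiff : ∀ α : ℝ, 0 < α →
      ((fun x : ℝ => y x) =o[𝓝 0] (fun x : ℝ => |x| ^ α) ↔ α < ((s - d + 1 : ℕ) : ℝ)) := by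
    intro α hα
    constructor
    · intro h
      by_contra! hle
      have hc := h.def (c := 1 / 4) (by norm_num)
      have hev : ∀ᶠ x : ℝ in 𝓝[≠] 0, False := by
        filter_upwards [nhdsWithin_le_nhds hc, nhdsWithin_le_nhds hb, nhdsWithin_le_nhds h1,
          self_mem_nhdsWithin] with x hx hx2 hx3 hx4
        have hpos : 0 < |x| := abs_pos.2 hx4
        have hmono : |x| ^ α ≤ |x| ^ (s - d + 1) := by
          rw [← Real.rpow_natCast]
          exact Real.rpow_le_rpow_of_exponent_ge hpos hx3.le hle
        have hpp : 0 < |x| ^ (s - d + 1) := by positivity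
        rw [Real.norm_eq_abs, Real.norm_eq_abs, abs_of_nonneg (a := |x| ^ α) (by positivity)] at hx
        linarith [hx2.2]
      exact hev.exists.elim (fun _ hf => hf)
    · intro hlt
      have hO : (fun x : ℝ => y x) =O[𝓝 0] (fun x : ℝ => |x| ^ (s - d + 1)) := by
        refine IsBigO.of_bound 1 ?_
        filter_upwards [hb] with x hx
        simpa using hx.1
      refine hO.trans_isLittleO ?_
      have ht : Tendsto (fun x : ℝ => |x| ^ (((s - d + 1 : ℕ) : ℝ) - α)) (𝓝 0) (𝓝 0) := by
        have hc : Continuous (fun x : ℝ => |x| ^ (((s - d + 1 : ℕ) : ℝ) - α)) :=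
          continuous_abs.rpow_const (fun x => Or.inr (by linarith))
        refine hc.tendsto' 0 0 ?_
        rw [abs_zero, Real.zero_rpow (by linarith)]
      have ho := ((isLittleO_one_iff ℝ).2 ht).mul_isBigO
        (isBigO_refl (fun x : ℝ => |x| ^ α) (𝓝 0))
      refine ho.congr (fun x => ?_) (fun x => one_mul _)
      rw [← Real.rpow_natCast, ← Real.rpow_add_of_nonneg (abs_nonneg x) (by linarith) hα.le]
      congr 1; ring
  refine ⟨?_, ?_, ?_⟩
  · have := (hiff ((s - d : ℕ) : ℝ) (by exact_mod_cast (by omega : 0 < s - d))).2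
      (by exact_mod_cast Nat.lt_succ_self _)
    simpa only [Real.rpow_natCast] using this
  · intro h
    refine lt_irrefl _ ((hiff ((s - d + 1 : ℕ) : ℝ) (by positivity)).1 ?_)
    simpa only [Real.rpow_natCast] using h
  · have : {α : ℝ | 0 < α ∧ (fun x : ℝ => y x) =o[𝓝 0] fun x : ℝ => |x| ^ α}
        = Set.Ioo 0 ((s - d + 1 : ℕ) : ℝ) := by
      ext α
      exact and_congr_right (hiff α)
    rw [this, hcast, csSup_Ioo (by positivity)]
end

section
/- Let d, s be natural numbers with 1 < d < s and d even. Then there exist ε > 0 and a function ỹ : ℝ → ℝ which is C^∞ on (−ε, ε), with ỹ(0) = 0 and derivative ỹ′(0) = −1, such that for every x ∈ (−ε, ε) one has ỹ(x)^d + ỹ(x) · x^{d−1} + x^s = 0. (Thus for even d the curve Z = {y^d + y x^{d−1} + x^s = 0} has a second branch through the origin, transversal to the x-axis.) -/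
open Topology in
theorem local_inverse_aux (d : ℕ) (hd : 1 < d) (heven : Even d) :
    ∃ h : ℝ → ℝ, h 0 = -1 ∧ (∀ᶠ t in 𝓝 (0 : ℝ), ContDiffAt ℝ (⊤ : ℕ∞) h t) ∧
      (∀ᶠ t in 𝓝 (0 : ℝ), h t ^ d + h t = -t) := by
  have hf : ContDiffAt ℝ (⊤ : WithTop ℕ∞) (fun u : ℝ => -(u ^ d + u)) (-1) := by fun_prop
  have hodd : Odd (d - 1) := Nat.Even.sub_odd (by omega) heven odd_one
  have hc : -((d : ℝ) * (-1) ^ (d - 1) + 1) ≠ 0 := by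
    rw [hodd.neg_one_pow]
    have : (1 : ℝ) < d := by exact_mod_cast hd
    intro h
    linarith
  have hder : HasDerivAt (fun u : ℝ => -(u ^ d + u)) (-((d : ℝ) * (-1) ^ (d - 1) + 1)) (-1) :=
    ((hasDerivAt_pow d (-1 : ℝ)).add (hasDerivAt_id _)).neg
  have hF := hder.hasFDerivAt_equiv hc
  have h0 : -((-1 : ℝ) ^ d + -1) = 0 := by rw [heven.neg_one_pow]; norm_num
  have hn : (⊤ : WithTop ℕ∞) ≠ 0 := by simp
  refine ⟨hf.localInverse hF hn, ?_, ?_, ?_⟩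
  · have := hf.localInverse_apply_image hF hn
    simpa only [h0] using this
  · have := hf.to_localInverse hF hn
    simp only [h0] at this
    have h2 := this.analyticAt.eventually_analyticAt
    filter_upwards [h2] with t ht using ht.contDiffAt
  · have := (hf.hasStrictFDerivAt' hF hn).eventually_right_inverse
    simp only [h0] at this
    filter_upwards [this] with t ht
    have h3 : -((hf.localInverse hF hn t) ^ d + hf.localInverse hF hn t) = t := ht
    linarith

open Topology in
theorem tworzewski_second_branch (d s : ℕ) (hd : 1 < d) (hds : d < s)
    (heven : Even d) :
    ∃ ε > (0 : ℝ), ∃ yt : ℝ → ℝ,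
      ContDiffOn ℝ (⊤ : ℕ∞) yt (Set.Ioo (-ε) ε) ∧ yt 0 = 0 ∧
      HasDerivAt yt (-1) 0 ∧
      (∀ x ∈ Set.Ioo (-ε) ε, yt x ^ d + yt x * x ^ (d - 1) + x ^ s = 0) := by
  obtain ⟨h, h0, hs, he⟩ := local_inverse_aux d hd heven
  have hk : s - d ≠ 0 := by omega
  have ht : Filter.Tendsto (fun x : ℝ => x ^ (s - d)) (𝓝 0) (𝓝 0) := by
    have : Continuous (fun x : ℝ => x ^ (s - d)) := by fun_prop
    simpa [hk] using this.tendsto 0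
  obtain ⟨ε, hε, hb⟩ := Metric.eventually_nhds_iff.1 ((ht.eventually hs).and (ht.eventually he))
  have hmem : ∀ x ∈ Set.Ioo (-ε) ε, dist x 0 < ε := by
    intro x hx
    rw [Real.dist_eq, sub_zero, abs_lt]
    exact hx
  have hsm : ∀ x ∈ Set.Ioo (-ε) ε, ContDiffAt ℝ (⊤ : ℕ∞) (fun x => h (x ^ (s - d))) x := by
    intro x hx
    exact ContDiffAt.comp x (hb (hmem x hx)).1 (by fun_prop)
  refine ⟨ε, hε, fun x => x * h (x ^ (s - d)), ?_, by simp, ?_, ?_⟩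
  · intro x hx
    exact (contDiffAt_id.mul (hsm x hx)).contDiffWithinAt
  · have h1 := (hsm 0 ⟨by linarith, hε⟩).differentiableAt (by simp)
    have h2 := (hasDerivAt_id (0 : ℝ)).mul h1.hasDerivAt
    refine h2.congr_deriv ?_
    simp [hk, h0]
  · intro x hx
    have h3 := (hb (hmem x hx)).2
    have e1 : x ^ s = x ^ d * x ^ (s - d) := by rw [← pow_add]; congr 1; omega
    have e2 : x * x ^ (d - 1) = x ^ d := by rw [← pow_succ']; congr 1; omega
    simp only [mul_pow]
    rw [e1]
    linear_combination x ^ d * h3 + h (x ^ (s - d)) * e2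
end
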